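/- Let n ∈ ℕ, let p > 0 be real, and set v(x) := |u_n(x)|^p u_n(x), where u_n = A₊ⁿ(e^{−x²/2}) is the n-th harmonic oscillator eigenfunction. Then the Fourier transform of v satisfies the symbolic decay estimate: there is a constant C = C(n,p) such that |𝔉v(ξ)| ≤ C (1 + |ξ|)^{−2−p} for all ξ ∈ ℝ. -/

import Mathlib

/-- The creation operator `A₊ = D_x + ix`, where `D_x = −i d/dx`. -/
noncomputable def Aplus (f : ℝ → ℂ) : ℝ → ℂ :=
  fun x => -Complex.I * deriv f x + Complex.I * (x : ℂ) * f x

/-- The annihilation operator `A₋ = D_x − ix`, where `D_x = −i d/dx`. -/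
noncomputable def Aminus (f : ℝ → ℂ) : ℝ → ℂ :=
  fun x => -Complex.I * deriv f x - Complex.I * (x : ℂ) * f x

/-- The `n`-th harmonic oscillator eigenfunction `u_n = A₊ⁿ(e^{−x²/2})`. -/
noncomputable def uHO (n : ℕ) : ℝ → ℂ :=
  Aplus^[n] (fun x : ℝ => Complex.exp (-(x : ℂ) ^ 2 / 2))

/-- The power nonlinearity `v = |u_n|^p u_n` of the `n`-th eigenfunction. -/
noncomputable def vNL (n : ℕ) (p : ℝ) : ℝ → ℂ :=
  fun x => ((‖uHO n x‖ ^ p : ℝ) : ℂ) * uHO n x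

open MeasureTheory

/-- The Fourier transform on `ℝ` normalized by `𝔉f(ξ) = (2π)^{−1/2} ∫ e^{−ixξ} f(x) dx`. -/
noncomputable def fourier1 (f : ℝ → ℂ) (ξ : ℝ) : ℂ :=
  (((2 * Real.pi) ^ (-(1 : ℝ) / 2) : ℝ) : ℂ) *
    ∫ x : ℝ, Complex.exp (-Complex.I * (x : ℂ) * (ξ : ℂ)) * f x

section Helpers

open Polynomial


lemma poly_int (b : ℝ) (hb : 0 < b) (r : ℝ[X]) :
    Integrable (fun x : ℝ => r.eval x * Real.exp (-b * x ^ 2)) := by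
  induction r using Polynomial.induction_on' with
  | add p q hp hq => exact (hp.add hq).congr (Filter.Eventually.of_forall fun x => by simp [add_mul])
  | monomial n c =>
    have h := integrable_rpow_mul_exp_neg_mul_sq hb (s := (n : ℝ))
      (by have : (0:ℝ) ≤ n := Nat.cast_nonneg n
          linarith)
    simp only [Real.rpow_natCast] at h
    simpa [eval_monomial, mul_assoc] using h.const_mul c

lemma poly_deriv (b : ℝ) (r : ℝ[X]) (x : ℝ) :
    HasDerivAt (fun x : ℝ => r.eval x * Real.exp (-b * x ^ 2))
      ((derivative r - C (2 * b) * X * r).eval x * Real.exp (-b * x ^ 2)) x := by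
  have h1 := r.hasDerivAt x
  have h2 : HasDerivAt (fun x : ℝ => Real.exp (-b * x ^ 2)) (Real.exp (-b * x ^ 2) * (-b * (2 * x))) x := by
    have := ((hasDerivAt_pow 2 x).const_mul (-b)).exp
    simpa using this
  refine (h1.mul h2).congr_deriv ?_
  simp
  ring

lemma sublevel (q : ℝ[X]) (hq : IsCoprime q (derivative q)) (σ : ℝ) (hσ : 1 < σ)
    (b : ℝ) (hb : 0 < b) (r : ℝ[X]) :
    ∃ K : ℝ, ∀ δ : ℝ, 0 < δ →
      |∫ x : ℝ, (1 + |q.eval x / δ|) ^ (-σ) * (r.eval x * Real.exp (-b * x ^ 2))| ≤ K * δ := by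
  obtain ⟨A, B, hAB⟩ := hq
  have hgc : Continuous (fun t : ℝ => (1 + |t|) ^ (-σ)) := by
    refine Continuous.rpow_const (by fun_prop) (fun x => Or.inl ?_)
    positivity
  have hgi : Integrable (fun t : ℝ => (1 + |t|) ^ (-σ)) := by
    have := integrable_one_add_norm (E := ℝ) (μ := volume) (r := σ) (by simpa using hσ)
    simpa using this
  have hg0 : ∀ t : ℝ, 0 ≤ (1 + |t|) ^ (-σ) := fun t => by positivity
  have hg1 : ∀ t : ℝ, (1 + |t|) ^ (-σ) ≤ 1 := fun t =>
    Real.rpow_le_one_of_one_le_of_nonpos (by linarith [abs_nonneg t]) (by linarith)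
  have hgt : ∀ t : ℝ, (1 + |t|) ^ (-σ) * |t| ≤ 1 := fun t => by
    have h1 : (1 + |t|) ^ (-σ) ≤ (1 + |t|) ^ (-1 : ℝ) :=
      Real.rpow_le_rpow_of_exponent_le (by linarith [abs_nonneg t]) (by linarith)
    have h2 : (0:ℝ) < 1 + |t| := by positivity
    rw [Real.rpow_neg_one] at h1
    calc _ ≤ (1 + |t|)⁻¹ * (1 + |t|) :=
          mul_le_mul h1 (by linarith) (abs_nonneg t) (by positivity)
      _ = 1 := inv_mul_cancel₀ h2.ne'
  set g : ℝ → ℝ := fun t : ℝ => (1 + |t|) ^ (-σ) with hg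
  set Ψ : ℝ → ℝ := fun t => ∫ s in (0:ℝ)..t, g s with hΨ
  have hΨd : ∀ t, HasDerivAt Ψ (g t) t := fun t =>
    intervalIntegral.integral_hasDerivAt_right (hgc.intervalIntegrable _ _)
      hgc.stronglyMeasurable.stronglyMeasurableAtFilter hgc.continuousAt
  have hΨb : ∀ t, |Ψ t| ≤ ∫ s, g s := fun t => by
    rw [← Real.norm_eq_abs]
    refine (intervalIntegral.norm_integral_le_integral_norm_uIoc).trans ?_
    refine (setIntegral_le_integral hgi.norm (Filter.Eventually.of_forall fun x => norm_nonneg _)).trans ?_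
    refine le_of_eq (integral_congr_ae (Filter.Eventually.of_forall fun x => ?_))
    exact Real.norm_of_nonneg (hg0 x)
  have hΨc : Continuous Ψ := continuous_iff_continuousAt.2 fun t => (hΨd t).continuousAt
  set E : ℝ → ℝ := fun x => Real.exp (-b * x ^ 2) with hE
  have hEc : Continuous E := by fun_prop
  set D : ℝ[X] := derivative (B * r) - C (2 * b) * X * (B * r) with hD
  refine ⟨(∫ x, |(A * r).eval x * E x|) + (∫ s, g s) * ∫ x, |D.eval x * E x|, fun δ hδ => ?_⟩
  have hbi : ∀ (s : ℝ[X]) (f : ℝ → ℝ) (K : ℝ), Continuous f → (∀ x, |f x| ≤ K) →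
      Integrable (fun x => f x * (s.eval x * E x)) := fun s f K hf hK =>
    (poly_int b hb s).bdd_mul (c := K) hf.aestronglyMeasurable (Filter.Eventually.of_forall hK)
  have hqc : Continuous (fun x => q.eval x / δ) := by fun_prop
  have hgb : ∀ x, |g (q.eval x / δ)| ≤ 1 := fun x => by rw [abs_of_nonneg (hg0 _)]; exact hg1 _
  have hI := fun s => hbi s (fun x => g (q.eval x / δ)) 1 (hgc.comp hqc) hgb
  have hJ := hbi D (fun x => Ψ (q.eval x / δ)) _ (hΨc.comp hqc) (fun x => hΨb _)
  have split : ∀ x, g (q.eval x / δ) * (r.eval x * E x) =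
      g (q.eval x / δ) * ((A * q * r).eval x * E x) +
      g (q.eval x / δ) * ((B * derivative q * r).eval x * E x) := fun x => by
    have : r = A * q * r + B * derivative q * r := by rw [← add_mul, hAB, one_mul]
    conv_lhs => rw [this]
    simp only [eval_add]; ring
  have ibp : (∫ x, g (q.eval x / δ) * ((B * derivative q * r).eval x * E x)) =
      - (δ * ∫ x, Ψ (q.eval x / δ) * (D.eval x * E x)) := by
    have h0 : ∫ x, (g (q.eval x / δ) * ((B * derivative q * r).eval x * E x) +
        δ * (Ψ (q.eval x / δ) * (D.eval x * E x))) = 0 := by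
      refine integral_eq_zero_of_hasDerivAt_of_integrable
        (f := fun x => δ * (Ψ (q.eval x / δ) * ((B * r).eval x * E x))) (fun x => ?_)
        ((hI _).add (hJ.const_mul δ)) ((hbi (B * r) _ _ (hΨc.comp hqc) (fun x => hΨb _)).const_mul δ)
      have h1 := (hΨd (q.eval x / δ)).comp x ((q.hasDerivAt x).div_const δ)
      refine ((h1.mul (poly_deriv b (B * r) x)).const_mul δ).congr_deriv ?_
      simp only [hD, Function.comp, hE, eval_mul]
      field_simp
    rw [integral_add (hI _) (hJ.const_mul δ), integral_const_mul] at h0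
    linarith
  change |∫ x, g (q.eval x / δ) * (r.eval x * E x)| ≤ _
  simp_rw [split]
  rw [integral_add (hI _) (hI _), ibp]
  have b1 : |∫ x, g (q.eval x / δ) * ((A * q * r).eval x * E x)| ≤
      δ * ∫ x, |(A * r).eval x * E x| := by
    rw [← integral_const_mul, ← Real.norm_eq_abs]
    refine norm_integral_le_of_norm_le ((poly_int b hb (A * r)).abs.const_mul δ)
      (Filter.Eventually.of_forall fun x => ?_)
    have h := hgt (q.eval x / δ)
    rw [abs_div, abs_of_pos hδ, ← mul_div_assoc, div_le_one hδ, ← abs_of_pos hδ, abs_of_pos hδ] at h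
    rw [Real.norm_eq_abs]
    calc |g (q.eval x / δ) * ((A * q * r).eval x * E x)|
        = g (q.eval x / δ) * |q.eval x| * |(A * r).eval x * E x| := by
          simp only [eval_mul, abs_mul, abs_of_nonneg (hg0 _), hg]; ring
      _ ≤ δ * |(A * r).eval x * E x| := by
          refine mul_le_mul_of_nonneg_right ?_ (abs_nonneg _)
          simpa [hg, abs_div, abs_of_pos hδ] using h
  have b2 : |∫ x, Ψ (q.eval x / δ) * (D.eval x * E x)| ≤ (∫ s, g s) * ∫ x, |D.eval x * E x| := by
    rw [← integral_const_mul, ← Real.norm_eq_abs]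
    refine norm_integral_le_of_norm_le ((poly_int b hb D).abs.const_mul _)
      (Filter.Eventually.of_forall fun x => ?_)
    rw [Real.norm_eq_abs, abs_mul]
    exact mul_le_mul_of_nonneg_right (hΨb _) (abs_nonneg _)
  refine (abs_add_le _ _).trans ?_
  rw [abs_neg, abs_mul, abs_of_pos hδ]
  nlinarith

lemma exists_G (p : ℝ) : ∃ G : ℝ → ℝ, ContDiff ℝ ((⊤ : ℕ∞) : WithTop ℕ∞) G ∧
    (∀ k : ℕ, ∃ K : ℝ, ∀ t, |iteratedDeriv k G t| ≤ K * (1 + |t|) ^ (p + 1 - k)) ∧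
    (∀ t : ℝ, 2 ≤ |t| → G t = |t| ^ p * t) := by
  set G : ℝ → ℝ := fun t => Real.smoothTransition (t ^ 2 - 1) * (|t| ^ p * t) with hG
  have hGs : ContDiff ℝ ((⊤ : ℕ∞) : WithTop ℕ∞) G := by
    rw [contDiff_iff_contDiffAt]
    intro t
    by_cases ht : t = 0
    · have : G =ᶠ[nhds t] fun _ => 0 := by
        have : Set.Ioo (-1 : ℝ) 1 ∈ nhds t := by
          subst ht; exact Ioo_mem_nhds (by norm_num) (by norm_num)
        filter_upwards [this] with s hs
        simp only [hG]
        rw [Real.smoothTransition.zero_of_nonpos (by nlinarith [hs.1, hs.2]), zero_mul]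
      exact contDiffAt_const.congr_of_eventuallyEq this
    · refine ContDiffAt.mul ?_ (ContDiffAt.mul ?_ contDiffAt_id)
      · exact Real.smoothTransition.contDiffAt.comp t (by fun_prop)
      · exact (contDiffAt_abs ht).rpow_const_of_ne (abs_ne_zero.2 ht)
  have hGl : ∀ t : ℝ, 3 / 2 < |t| → G t = |t| ^ p * t := by
    intro t ht
    simp only [hG]
    rw [Real.smoothTransition.one_of_one_le (by nlinarith [sq_abs t]), one_mul]
  have hpos : ∀ k : ℕ, ∃ c : ℝ, ∀ t : ℝ, 3 / 2 < t → iteratedDeriv k G t = c * t ^ (p + 1 - k) := by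
    intro k
    induction k with
    | zero =>
      refine ⟨1, fun t ht => ?_⟩
      have h0 : 0 < t := by linarith
      rw [iteratedDeriv_zero, hGl t (by rwa [abs_of_pos h0]), abs_of_pos h0]
      simp [Real.rpow_add_one h0.ne']
    | succ k ih =>
      obtain ⟨c, hc⟩ := ih
      refine ⟨c * (p + 1 - k), fun t ht => ?_⟩
      have h0 : 0 < t := by linarith
      rw [iteratedDeriv_succ]
      have he : iteratedDeriv k G =ᶠ[nhds t] fun t => c * t ^ (p + 1 - k) := by
        filter_upwards [Ioi_mem_nhds ht] with s hs using hc s hs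
      rw [he.deriv_eq]
      have hd := (Real.hasDerivAt_rpow_const (x := t) (p := p + 1 - k) (Or.inl h0.ne')).const_mul c
      rw [hd.deriv, mul_assoc]
      push_cast
      congr 3; ring
  have hneg : ∀ k : ℕ, ∃ c : ℝ, ∀ t : ℝ, t < -(3 / 2) →
      iteratedDeriv k G t = c * (-t) ^ (p + 1 - k) := by
    intro k
    induction k with
    | zero =>
      refine ⟨-1, fun t ht => ?_⟩
      have h0 : 0 < -t := by linarith
      have h1 : |t| = -t := abs_of_neg (by linarith)
      rw [iteratedDeriv_zero, hGl t (by rw [h1]; linarith), h1]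
      simp [Real.rpow_add_one h0.ne']
    | succ k ih =>
      obtain ⟨c, hc⟩ := ih
      refine ⟨-(c * (p + 1 - k)), fun t ht => ?_⟩
      have h0 : 0 < -t := by linarith
      rw [iteratedDeriv_succ]
      have he : iteratedDeriv k G =ᶠ[nhds t] fun t => c * (-t) ^ (p + 1 - k) := by
        filter_upwards [Iio_mem_nhds ht] with s hs using hc s hs
      rw [he.deriv_eq]
      have hd := (((hasDerivAt_id t).neg).rpow_const (p := p + 1 - k) (Or.inl h0.ne')).const_mul c
      have hd2 := hd.deriv
      simp only [Pi.neg_apply, id] at hd2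
      rw [hd2]
      push_cast
      rw [show p + 1 - (k + 1 : ℝ) = p + 1 - k - 1 by ring]
      ring
  refine ⟨G, hGs, fun k => ?_, fun t ht => hGl t (by linarith)⟩
  obtain ⟨c, hc⟩ := hpos k
  obtain ⟨d, hd⟩ := hneg k
  have hcont : Continuous (iteratedDeriv k G) :=
    hGs.continuous_iteratedDeriv k (by exact_mod_cast le_top)
  have hj : ∀ t : ℝ, 0 < (1 + |t|) ^ (p + 1 - k) := fun t => by positivity
  obtain ⟨B, hB⟩ := (isCompact_Icc (a := (-2 : ℝ)) (b := 2)).exists_bound_of_continuousOn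
    (f := fun t => iteratedDeriv k G t / (1 + |t|) ^ (p + 1 - k))
    ((hcont.div (Continuous.rpow_const (by fun_prop) fun t => Or.inl (by positivity))
      (fun t => (hj t).ne')).continuousOn)
  set Q : ℝ := max 1 ((2 : ℝ) ^ (-(p + 1 - k))) with hQ
  have hQ0 : 0 ≤ Q := le_trans zero_le_one (le_max_left _ _)
  have hcmp : ∀ s : ℝ, 1 ≤ s → s ^ (p + 1 - k) ≤ Q * (1 + s) ^ (p + 1 - k) := by
    intro s hs
    have hs0 : 0 < s := by linarith
    by_cases hm : 0 ≤ p + 1 - k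
    · have h1 : s ^ (p + 1 - k) ≤ (1 + s) ^ (p + 1 - k) :=
        Real.rpow_le_rpow hs0.le (by linarith) hm
      have h2 : 0 ≤ (1 + s) ^ (p + 1 - k) := by positivity
      nlinarith [le_max_left 1 ((2 : ℝ) ^ (-(p + 1 - k)))]
    · have h1 : (2 * s) ^ (p + 1 - k) ≤ (1 + s) ^ (p + 1 - k) :=
        Real.rpow_le_rpow_of_nonpos (by linarith) (by linarith) (by linarith)
      rw [Real.mul_rpow (by norm_num) hs0.le] at h1
      have h2 : (2:ℝ) ^ (-(p + 1 - k)) * ((2:ℝ) ^ (p + 1 - k)) = 1 := by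
        rw [← Real.rpow_add (by norm_num)]; simp
      calc s ^ (p + 1 - k) = (2:ℝ) ^ (-(p + 1 - k)) * ((2:ℝ) ^ (p + 1 - k) * s ^ (p + 1 - k)) := by
            rw [← mul_assoc, h2, one_mul]
        _ ≤ (2:ℝ) ^ (-(p + 1 - k)) * (1 + s) ^ (p + 1 - k) :=
            mul_le_mul_of_nonneg_left h1 (by positivity)
        _ ≤ _ := mul_le_mul_of_nonneg_right (le_max_right _ _) (by positivity)
  refine ⟨|B| + |c| * Q + |d| * Q, fun t => ?_⟩
  have hcQ : 0 ≤ |c| * Q := by positivity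
  have hdQ : 0 ≤ |d| * Q := by positivity
  have hBB := abs_nonneg B
  have hjt := hj t
  by_cases h1 : 2 < t
  · have h0 : 0 < t := by linarith
    have := hcmp t (by linarith)
    rw [hc t (by linarith), abs_mul, abs_of_nonneg (Real.rpow_nonneg h0.le _)]
    rw [abs_of_pos h0] at hjt ⊢
    have := mul_le_mul_of_nonneg_left this (abs_nonneg c)
    nlinarith [mul_nonneg hBB hjt.le, mul_nonneg hdQ hjt.le]
  · by_cases h2 : t < -2
    · have h0 : 0 < -t := by linarith
      have := hcmp (-t) (by linarith)
      rw [hd t (by linarith), abs_mul, abs_of_nonneg (Real.rpow_nonneg h0.le _)]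
      rw [abs_of_neg (by linarith : t < 0)] at hjt ⊢
      have := mul_le_mul_of_nonneg_left this (abs_nonneg d)
      nlinarith [mul_nonneg hBB hjt.le, mul_nonneg hcQ hjt.le]
    · have := hB t ⟨by linarith, by linarith⟩
      rw [Real.norm_eq_abs, abs_div, abs_of_pos hjt, div_le_iff₀ hjt] at this
      nlinarith [mul_nonneg hdQ hjt.le, mul_nonneg hcQ hjt.le, le_abs_self B]

lemma dominate (q : ℝ[X]) (hq : IsCoprime q (derivative q)) (p : ℝ) (M : ℕ) (hM : p + 2 < M)
    (b : ℝ) (hb : 0 < b) (k : ℕ) (hk : k ≤ M) (f : ℝ → ℝ) (hf : Continuous f) (K0 : ℝ)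
    (hK0 : ∀ t, |f t| ≤ K0 * (1 + |t|) ^ (p + 1 - k)) (r : ℝ[X]) :
    ∃ K : ℝ, ∀ δ : ℝ, 0 < δ → δ ≤ 1 →
      Integrable (fun x : ℝ => f (q.eval x / δ) / δ ^ k * (r.eval x * Real.exp (-b * x ^ 2))) ∧
      ∫ x : ℝ, |f (q.eval x / δ) / δ ^ k * (r.eval x * Real.exp (-b * x ^ 2))| ≤ K * (δ / δ ^ M) := by
  set σ : ℝ := M - p - 1 with hσ
  set R : ℝ[X] := (C 2 + q ^ 2) ^ M * (1 + r ^ 2) with hR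
  obtain ⟨K, hK⟩ := sublevel q hq σ (by rw [hσ]; linarith) b hb R
  have hK00 : 0 ≤ K0 := by
    have := (abs_nonneg _).trans (hK0 0)
    simpa using this
  refine ⟨K0 * K, fun δ hδ hδ1 => ?_⟩
  have hgc : Continuous (fun x : ℝ => (1 + |q.eval x / δ|) ^ (-σ)) := by
    refine Continuous.rpow_const (by fun_prop) (fun x => Or.inl ?_)
    positivity
  have hint : Integrable (fun x : ℝ => (1 + |q.eval x / δ|) ^ (-σ) * (R.eval x * Real.exp (-b * x ^ 2))) := by
    refine (poly_int b hb R).bdd_mul (c := 1) hgc.aestronglyMeasurable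
      (Filter.Eventually.of_forall fun x => ?_)
    rw [Real.norm_of_nonneg (by positivity)]
    exact Real.rpow_le_one_of_one_le_of_nonpos (by linarith [abs_nonneg (q.eval x / δ)])
      (by rw [hσ]; linarith)
  have hint2 := hint.const_mul (K0 / δ ^ M)
  have hpt : ∀ x : ℝ, |f (q.eval x / δ) / δ ^ k * (r.eval x * Real.exp (-b * x ^ 2))| ≤
      K0 / δ ^ M * ((1 + |q.eval x / δ|) ^ (-σ) * (R.eval x * Real.exp (-b * x ^ 2))) := by
    intro x
    set y := q.eval x with hy
    set E := Real.exp (-b * x ^ 2) with hE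
    have hE0 : 0 < E := Real.exp_pos _
    have h1 := hK0 (y / δ)
    have hu : (0:ℝ) < 1 + |y / δ| := by positivity
    have h2 : (1 + |y / δ|) ^ (p + 1 - k) = (1 + |y / δ|) ^ (-σ) * (1 + |y / δ|) ^ (M - k) := by
      rw [← Real.rpow_natCast (1 + |y / δ|) (M - k), ← Real.rpow_add hu, Nat.cast_sub hk]
      congr 1; rw [hσ]; ring
    have h3 : 1 + |y / δ| ≤ (2 + y ^ 2) / δ := by
      rw [abs_div, abs_of_pos hδ, le_div_iff₀ hδ, add_mul, div_mul_cancel₀ _ hδ.ne']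
      nlinarith [sq_abs y, sq_nonneg (|y| - 1)]
    have h4 : (1 + |y / δ|) ^ (M - k) ≤ (2 + y ^ 2) ^ M / δ ^ (M - k) := by
      refine (pow_le_pow_left₀ hu.le h3 _).trans ?_
      rw [div_pow]
      refine div_le_div_of_nonneg_right (pow_le_pow_right₀ (by nlinarith [sq_nonneg y]) (Nat.sub_le _ _)) (by positivity)
    have h5 : |r.eval x| ≤ 1 + (r.eval x) ^ 2 := by
      nlinarith [sq_abs (r.eval x), sq_nonneg (|r.eval x| - 1)]
    have h6 : R.eval x = (2 + y ^ 2) ^ M * (1 + (r.eval x) ^ 2) := by simp [hR, hy]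
    have h7 : δ ^ M = δ ^ (M - k) * δ ^ k := by rw [← pow_add, Nat.sub_add_cancel hk]
    have hg0 : 0 ≤ (1 + |y / δ|) ^ (-σ) := by positivity
    rw [abs_mul, abs_div, abs_mul, abs_of_pos hE0, abs_of_pos (pow_pos hδ k), h6, h7]
    calc |f (y / δ)| / δ ^ k * (|r.eval x| * E)
        ≤ (K0 * ((1 + |y / δ|) ^ (-σ) * ((2 + y ^ 2) ^ M / δ ^ (M - k)))) / δ ^ k *
          ((1 + (r.eval x) ^ 2) * E) := by
          rw [h2] at h1
          have := h1.trans (mul_le_mul_of_nonneg_left (mul_le_mul_of_nonneg_left h4 hg0) hK00)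
          gcongr
      _ = _ := by field_simp
  refine ⟨hint2.mono' (by
      refine Continuous.aestronglyMeasurable ?_
      have : Continuous fun x : ℝ => f (q.eval x / δ) := hf.comp (by fun_prop)
      fun_prop) (Filter.Eventually.of_forall hpt), ?_⟩
  refine (integral_mono_of_nonneg (Filter.Eventually.of_forall fun x => abs_nonneg _) hint2
    (Filter.Eventually.of_forall hpt)).trans ?_
  rw [integral_const_mul]
  have := (le_abs_self _).trans (hK δ hδ)
  calc _ ≤ K0 / δ ^ M * (K * δ) := mul_le_mul_of_nonneg_left this (by positivity)
    _ = _ := by ring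

lemma osc_norm (x ξ : ℝ) : ‖Complex.exp (-Complex.I * (x : ℂ) * (ξ : ℂ))‖ = 1 := by
  rw [Complex.norm_exp]; simp

lemma osc_deriv (x ξ : ℝ) : HasDerivAt (fun x : ℝ => Complex.exp (-Complex.I * (x : ℂ) * (ξ : ℂ)))
    (Complex.exp (-Complex.I * (x : ℂ) * (ξ : ℂ)) * (-Complex.I * ξ)) x := by
  have h : HasDerivAt (fun x : ℝ => (x : ℂ)) 1 x := Complex.ofRealCLM.hasDerivAt
  have := ((h.const_mul (-Complex.I)).mul_const (ξ : ℂ)).cexp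
  simpa using this

lemma osc_int (f : ℝ → ℝ) (hf : Integrable f) (ξ : ℝ) :
    Integrable (fun x : ℝ => Complex.exp (-Complex.I * (x : ℂ) * (ξ : ℂ)) * ((f x : ℝ) : ℂ)) :=
  hf.ofReal.bdd_mul (c := 1) (Continuous.aestronglyMeasurable (by fun_prop))
    (Filter.Eventually.of_forall fun x => (osc_norm x ξ).le)

lemma osc_bound (f : ℝ → ℝ) (ξ : ℝ) :
    ‖∫ x : ℝ, Complex.exp (-Complex.I * (x : ℂ) * (ξ : ℂ)) * ((f x : ℝ) : ℂ)‖ ≤ ∫ x, |f x| := by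
  refine (norm_integral_le_integral_norm _).trans (le_of_eq ?_)
  congr 1; ext x
  rw [norm_mul, osc_norm, one_mul, Complex.norm_real, Real.norm_eq_abs]

lemma osc_ibp (f f' : ℝ → ℝ) (hf : Integrable f) (hf' : Integrable f')
    (hd : ∀ x, HasDerivAt f (f' x) x) (ξ : ℝ) :
    |ξ| * ‖∫ x : ℝ, Complex.exp (-Complex.I * (x : ℂ) * (ξ : ℂ)) * ((f x : ℝ) : ℂ)‖ =
      ‖∫ x : ℝ, Complex.exp (-Complex.I * (x : ℂ) * (ξ : ℂ)) * ((f' x : ℝ) : ℂ)‖ := by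
  have h0 : ∫ x : ℝ, ((-Complex.I * ξ) * (Complex.exp (-Complex.I * (x : ℂ) * (ξ : ℂ)) * ((f x : ℝ) : ℂ))
      + Complex.exp (-Complex.I * (x : ℂ) * (ξ : ℂ)) * ((f' x : ℝ) : ℂ)) = 0 := by
    refine integral_eq_zero_of_hasDerivAt_of_integrable
      (f := fun x : ℝ => Complex.exp (-Complex.I * (x : ℂ) * (ξ : ℂ)) * ((f x : ℝ) : ℂ)) (fun x => ?_)
      (((osc_int f hf ξ).const_mul _).add (osc_int f' hf' ξ)) (osc_int f hf ξ)
    refine ((osc_deriv x ξ).mul (hd x).ofReal_comp).congr_deriv ?_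
    ring
  rw [integral_add ((osc_int f hf ξ).const_mul _) (osc_int f' hf' ξ), integral_const_mul] at h0
  rw [← neg_eq_of_add_eq_zero_right h0, norm_neg, norm_mul, norm_mul, norm_neg, Complex.norm_I,
    Complex.norm_real, one_mul, Real.norm_eq_abs]

lemma main_ind (q : ℝ[X]) (hq : IsCoprime q (derivative q)) (p : ℝ) (M : ℕ) (hM : p + 2 < M)
    (b : ℝ) (hb : 0 < b) (G : ℝ → ℝ) (hG : ContDiff ℝ ((⊤ : ℕ∞) : WithTop ℕ∞) G)
    (hGb : ∀ k : ℕ, ∃ K : ℝ, ∀ t, |iteratedDeriv k G t| ≤ K * (1 + |t|) ^ (p + 1 - k)) (j : ℕ) :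
    ∀ k : ℕ, k + j ≤ M → ∀ r : ℝ[X], ∃ K : ℝ, ∀ δ : ℝ, 0 < δ → δ ≤ 1 → ∀ ξ : ℝ,
      (1 + |ξ|) ^ j * ‖∫ x : ℝ, Complex.exp (-Complex.I * (x : ℂ) * (ξ : ℂ)) *
        ((iteratedDeriv k G (q.eval x / δ) / δ ^ k * (r.eval x * Real.exp (-b * x ^ 2)) : ℝ) : ℂ)‖
        ≤ K * (δ / δ ^ M) := by
  have hc : ∀ k, Continuous (iteratedDeriv k G) := fun k =>
    hG.continuous_iteratedDeriv k (by exact_mod_cast le_top)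
  have hdd : ∀ k t, HasDerivAt (iteratedDeriv k G) (iteratedDeriv (k + 1) G t) t := fun k t => by
    rw [iteratedDeriv_succ]
    exact (hG.differentiable_iteratedDeriv k (by exact_mod_cast WithTop.coe_lt_top k) t).hasDerivAt
  have dom : ∀ k, k ≤ M → ∀ r : ℝ[X], ∃ K : ℝ, ∀ δ : ℝ, 0 < δ → δ ≤ 1 →
      Integrable (fun x : ℝ => iteratedDeriv k G (q.eval x / δ) / δ ^ k * (r.eval x * Real.exp (-b * x ^ 2))) ∧
      ∫ x : ℝ, |iteratedDeriv k G (q.eval x / δ) / δ ^ k * (r.eval x * Real.exp (-b * x ^ 2))| ≤ K * (δ / δ ^ M) := by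
    intro k hk r
    obtain ⟨K0, hK0⟩ := hGb k
    exact dominate q hq p M hM b hb k hk _ (hc k) K0 hK0 r
  induction j with
  | zero =>
    intro k hk r
    obtain ⟨K, hK⟩ := dom k (by omega) r
    refine ⟨K, fun δ hδ hδ1 ξ => ?_⟩
    rw [pow_zero, one_mul]
    exact (osc_bound _ ξ).trans (hK δ hδ hδ1).2
  | succ j ih =>
    intro k hk r
    set r1 : ℝ[X] := derivative q * r with hr1
    set r2 : ℝ[X] := derivative r - C (2 * b) * X * r with hr2
    obtain ⟨K0, h0⟩ := ih k (by omega) r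
    obtain ⟨K1, h1⟩ := ih (k + 1) (by omega) r1
    obtain ⟨K2, h2⟩ := ih k (by omega) r2
    obtain ⟨L0, d0⟩ := dom k (by omega) r
    obtain ⟨L1, d1⟩ := dom (k + 1) (by omega) r1
    obtain ⟨L2, d2⟩ := dom k (by omega) r2
    refine ⟨K0 + K1 + K2, fun δ hδ hδ1 ξ => ?_⟩
    have i0 := (d0 δ hδ hδ1).1
    have i1 := (d1 δ hδ hδ1).1
    have i2 := (d2 δ hδ hδ1).1
    have key := osc_ibp _ _ i0 (i1.add i2) (fun x => by
      have h1 := ((hdd k (q.eval x / δ)).comp x ((q.hasDerivAt x).div_const δ)).div_const (δ ^ k)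
      refine (h1.mul (poly_deriv b r x)).congr_deriv ?_
      simp only [hr1, hr2, Function.comp, eval_mul, Pi.add_apply, pow_succ]
      field_simp) ξ
    have e : (∫ x : ℝ, Complex.exp (-Complex.I * (x : ℂ) * (ξ : ℂ)) * ((((fun x : ℝ => iteratedDeriv (k + 1) G (q.eval x / δ) / δ ^ (k + 1) * (r1.eval x * Real.exp (-b * x ^ 2))) + (fun x : ℝ => iteratedDeriv k G (q.eval x / δ) / δ ^ k * (r2.eval x * Real.exp (-b * x ^ 2)))) x : ℝ) : ℂ)) = (∫ x : ℝ, Complex.exp (-Complex.I * (x : ℂ) * (ξ : ℂ)) * ((iteratedDeriv (k + 1) G (q.eval x / δ) / δ ^ (k + 1) * (r1.eval x * Real.exp (-b * x ^ 2)) : ℝ) : ℂ)) + ∫ x : ℝ, Complex.exp (-Complex.I * (x : ℂ) * (ξ : ℂ)) * ((iteratedDeriv k G (q.eval x / δ) / δ ^ k * (r2.eval x * Real.exp (-b * x ^ 2)) : ℝ) : ℂ) := by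
      rw [← integral_add (osc_int _ i1 ξ) (osc_int _ i2 ξ)]
      congr 1; ext x
      rw [Pi.add_apply, Complex.ofReal_add, mul_add]
    rw [e] at key
    have tri := norm_add_le (∫ x : ℝ, Complex.exp (-Complex.I * (x : ℂ) * (ξ : ℂ)) * ((iteratedDeriv (k + 1) G (q.eval x / δ) / δ ^ (k + 1) * (r1.eval x * Real.exp (-b * x ^ 2)) : ℝ) : ℂ)) (∫ x : ℝ, Complex.exp (-Complex.I * (x : ℂ) * (ξ : ℂ)) * ((iteratedDeriv k G (q.eval x / δ) / δ ^ k * (r2.eval x * Real.exp (-b * x ^ 2)) : ℝ) : ℂ))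
    have g0 := h0 δ hδ hδ1 ξ
    have g1 := h1 δ hδ hδ1 ξ
    have g2 := h2 δ hδ hδ1 ξ
    have hP : 0 ≤ (1 + |ξ|) ^ j := by positivity
    rw [← key] at tri
    have := mul_le_mul_of_nonneg_left tri hP
    rw [pow_succ]
    linarith

/-- Physicists' Hermite polynomials. -/
noncomputable def hermPoly : ℕ → ℝ[X]
  | 0 => 1
  | n + 1 => C 2 * X * hermPoly n - derivative (hermPoly n)

lemma hermPoly_deriv (n : ℕ) :
    derivative (hermPoly (n + 1)) = C (2 * ((n : ℝ) + 1)) * hermPoly n := by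
  induction n with
  | zero => simp [hermPoly]
  | succ n ih =>
    rw [hermPoly, derivative_sub, derivative_mul, ih, derivative_mul]
    simp only [derivative_C, derivative_X, derivative_mul]
    have : hermPoly (n + 1) = C 2 * X * hermPoly n - derivative (hermPoly n) := rfl
    rw [show (C (2 * ((n : ℝ) + 1)) : ℝ[X]) * hermPoly n = derivative (hermPoly (n + 1)) from ih.symm]
    have h2 : (C (2 * ((n : ℝ) + 1)) : ℝ[X]) * derivative (hermPoly n)
      = C 2 * X * (C (2 * ((n : ℝ) + 1)) * hermPoly n) - C (2 * ((n : ℝ) + 1)) * hermPoly (n + 1) := by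
      rw [this]; ring
    rw [ih]
    simp only [zero_mul, zero_add, mul_one]
    rw [h2]
    push_cast
    simp only [C_mul, C_add, C_1]
    ring

lemma hermPoly_coprime (n : ℕ) : IsCoprime (hermPoly n) (derivative (hermPoly n)) := by
  induction n with
  | zero => exact isCoprime_one_left
  | succ n ih =>
    rw [hermPoly_deriv]
    have hu : IsUnit (C (2 * ((n : ℝ) + 1)) : ℝ[X]) := by
      rw [isUnit_C]; exact IsUnit.mk0 _ (by positivity)
    refine (isCoprime_mul_unit_left_right hu _ _).2 ?_
    have h : hermPoly (n + 1) = -derivative (hermPoly n) + hermPoly n * (C 2 * X) := by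
      simp only [hermPoly]; ring
    rw [h]
    exact IsCoprime.add_mul_left_left ih.symm.neg_left _

lemma uHO_eq (n : ℕ) : uHO n = fun x : ℝ => Complex.I ^ n *
    (((hermPoly n).eval x * Real.exp (-(1 / 2) * x ^ 2) : ℝ) : ℂ) := by
  induction n with
  | zero =>
    funext x
    simp only [uHO, Function.iterate_zero, id, hermPoly, eval_one, one_mul, pow_zero]
    rw [Complex.ofReal_exp]
    congr 1; push_cast; ring
  | succ n ih =>
    have h : uHO (n + 1) = Aplus (uHO n) := by
      simp only [uHO, Function.iterate_succ_apply']
    rw [h, ih]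
    funext x
    have hd := ((poly_deriv (1 / 2) (hermPoly n) x).ofReal_comp).const_mul (Complex.I ^ n)
    simp only [Aplus]
    rw [hd.deriv]
    simp only [hermPoly, eval_sub, eval_mul, eval_C, eval_X]
    push_cast
    ring

lemma vNL_eq (n : ℕ) (p : ℝ) (x : ℝ) : vNL n p x = Complex.I ^ n *
    (((|(hermPoly n).eval x| ^ p * (hermPoly n).eval x) *
      Real.exp (-((p + 1) / 2) * x ^ 2) : ℝ) : ℂ) := by
  have hE : Real.exp (-((p + 1) / 2) * x ^ 2) =
      Real.exp (-(1 / 2) * x ^ 2) ^ p * Real.exp (-(1 / 2) * x ^ 2) := by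
    rw [← Real.exp_mul, ← Real.exp_add]; congr 1; ring
  simp only [vNL, uHO_eq]
  rw [norm_mul, norm_pow, Complex.norm_I, one_pow, one_mul, Complex.norm_real, Real.norm_eq_abs,
    abs_mul, abs_of_pos (Real.exp_pos _), Real.mul_rpow (abs_nonneg _) (Real.exp_pos _).le, hE]
  push_cast
  ring

lemma osc_decay (q : ℝ[X]) (hq : IsCoprime q (derivative q)) (p : ℝ) (hp : 0 < p)
    (b : ℝ) (hb : 0 < b) : ∃ K : ℝ, ∀ ξ : ℝ,
      ‖∫ x : ℝ, Complex.exp (-Complex.I * (x : ℂ) * (ξ : ℂ)) *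
        (((|q.eval x| ^ p * q.eval x) * Real.exp (-b * x ^ 2) : ℝ) : ℂ)‖
        ≤ K * (1 + |ξ|) ^ (-2 - p) := by
  obtain ⟨G, hG, hGb, hGe⟩ := exists_G p
  obtain ⟨M, hM⟩ := exists_nat_gt (p + 2)
  obtain ⟨K1, hK1⟩ := main_ind q hq p M hM b hb G hG hGb M 0 (by omega) 1
  obtain ⟨B, hB⟩ := hGb 0
  have hB0 : 0 ≤ B := by simpa using (abs_nonneg _).trans (hB 0)
  obtain ⟨L, hL⟩ := dominate q hq p M hM b hb 0 (by omega) G hG.continuous B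
    (by simpa using hB) 1
  set H : ℝ → ℝ := fun t => |t| ^ p * t - G t with hH
  have hHc : Continuous H := by
    have : Continuous fun t : ℝ => |t| ^ p :=
      continuous_abs.rpow_const (fun x => Or.inr hp.le)
    exact (this.mul continuous_id).sub hG.continuous
  have hHb : ∀ t, |H t| ≤ (1 + B) * 3 ^ M * (1 + |t|) ^ (p + 1 - M) := by
    intro t
    by_cases ht : 2 ≤ |t|
    · simp only [hH, hGe t ht, sub_self, abs_zero]; positivity
    · push Not at ht
      have h1 : (0:ℝ) < 1 + |t| := by positivity
      have h2 : |H t| ≤ (1 + B) * (1 + |t|) ^ (p + 1) := by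
        have a1 : |t| ^ p * |t| ≤ (1 + |t|) ^ (p + 1) := by
          rw [Real.rpow_add_one h1.ne']
          have : |t| ^ p ≤ (1 + |t|) ^ p := Real.rpow_le_rpow (abs_nonneg _) (by linarith) hp.le
          gcongr; linarith
        have a2 := hB t
        simp only [iteratedDeriv_zero, Nat.cast_zero, sub_zero] at a2
        have a3 : |H t| ≤ |t| ^ p * |t| + |G t| := by
          refine (abs_sub _ _).trans (le_of_eq ?_)
          rw [abs_mul, abs_of_nonneg (Real.rpow_nonneg (abs_nonneg t) p)]
        linarith
      refine h2.trans ?_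
      rw [mul_assoc]
      refine mul_le_mul_of_nonneg_left ?_ (by linarith)
      rw [Real.rpow_sub h1, Real.rpow_natCast, ← mul_div_assoc, le_div_iff₀ (by positivity), mul_comm]
      gcongr; linarith
  obtain ⟨K2, hK2⟩ := dominate q hq p M hM b hb M le_rfl H hHc _ hHb 1
  refine ⟨K1 + K2, fun ξ => ?_⟩
  have hX : 0 < 1 + |ξ| := by positivity
  set δ : ℝ := (1 + |ξ|)⁻¹ with hδd
  have hδ : 0 < δ := by positivity
  have hδ1 : δ ≤ 1 := inv_le_one_of_one_le₀ (by linarith [abs_nonneg ξ])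
  have hδM : 0 < δ ^ M := by positivity
  have iG := (hL δ hδ hδ1).1
  obtain ⟨iH, bH⟩ := hK2 δ hδ hδ1
  have g1 := hK1 δ hδ hδ1 ξ
  have g2 := (osc_bound _ ξ).trans bH
  simp only [iteratedDeriv_zero] at g1
  have hpt : ∀ x : ℝ, Complex.exp (-Complex.I * (x : ℂ) * (ξ : ℂ)) *
        (((|q.eval x| ^ p * q.eval x) * Real.exp (-b * x ^ 2) : ℝ) : ℂ) =
      ((δ ^ (p + 1) : ℝ) : ℂ) * (Complex.exp (-Complex.I * (x : ℂ) * (ξ : ℂ)) *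
        ((G (q.eval x / δ) / δ ^ 0 * ((1 : ℝ[X]).eval x * Real.exp (-b * x ^ 2)) : ℝ) : ℂ)) +
      ((δ ^ (p + 1) * δ ^ M : ℝ) : ℂ) * (Complex.exp (-Complex.I * (x : ℂ) * (ξ : ℂ)) *
        ((H (q.eval x / δ) / δ ^ M * ((1 : ℝ[X]).eval x * Real.exp (-b * x ^ 2)) : ℝ) : ℂ)) := by
    intro x
    have e1 : |q.eval x| ^ p * q.eval x =
        δ ^ (p + 1) * (G (q.eval x / δ) / δ ^ 0) + δ ^ (p + 1) * δ ^ M * (H (q.eval x / δ) / δ ^ M) := by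
      have : δ ^ (p + 1) * δ ^ M * (H (q.eval x / δ) / δ ^ M) = δ ^ (p + 1) * H (q.eval x / δ) := by
        field_simp
      rw [this]
      simp only [hH, pow_zero, div_one]
      rw [← mul_add, add_sub_cancel, Real.rpow_add_one hδ.ne', abs_div, abs_of_pos hδ,
        Real.div_rpow (abs_nonneg _) hδ.le]
      have := (Real.rpow_pos_of_pos hδ p).ne'
      field_simp
    rw [e1]
    simp only [eval_one]
    push_cast
    ring
  simp_rw [hpt]
  rw [integral_add ((osc_int _ iG ξ).const_mul _) ((osc_int _ iH ξ).const_mul _),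
    integral_const_mul, integral_const_mul]
  refine (norm_add_le _ _).trans ?_
  rw [norm_mul, norm_mul, Complex.norm_real, Complex.norm_real, Real.norm_of_nonneg (by positivity),
    Real.norm_of_nonneg (by positivity)]
  have hδr : (1 + |ξ|) ^ (-2 - p) = δ ^ (p + 1) * δ := by
    rw [← Real.rpow_add_one hδ.ne', hδd, Real.inv_rpow hX.le, ← Real.rpow_neg hX.le]
    congr 1; ring
  have hg : (1 + |ξ|) ^ M = (δ ^ M)⁻¹ := by rw [hδd, inv_pow, inv_inv]
  rw [hg, inv_mul_le_iff₀ hδM] at g1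
  have g1' := mul_le_mul_of_nonneg_left g1 (Real.rpow_nonneg hδ.le (p + 1))
  have g2' := mul_le_mul_of_nonneg_left g2
    (mul_nonneg (Real.rpow_nonneg hδ.le (p + 1)) hδM.le)
  rw [hδr]
  refine (add_le_add g1' g2').trans (le_of_eq ?_)
  field_simp

end Helpers

/-- the Fourier transform of `v = |u_n|^p u_n` satisfies the symbolic
decay estimate `|𝔉v(ξ)| ≤ C (1 + |ξ|)^{−2−p}`. -/
theorem power_nonlinearity_fourier_symbol (n : ℕ) (p : ℝ) (hp : 0 < p) :
    ∃ C : ℝ, ∀ ξ : ℝ, ‖fourier1 (vNL n p) ξ‖ ≤ C * (1 + |ξ|) ^ (-2 - p) := by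
  obtain ⟨K, hK⟩ := osc_decay (hermPoly n) (hermPoly_coprime n) p hp ((p + 1) / 2) (by linarith)
  refine ⟨(2 * Real.pi) ^ (-(1 : ℝ) / 2) * K, fun ξ => ?_⟩
  have hpt : ∀ x : ℝ, Complex.exp (-Complex.I * (x : ℂ) * (ξ : ℂ)) * vNL n p x =
      Complex.I ^ n * (Complex.exp (-Complex.I * (x : ℂ) * (ξ : ℂ)) *
        (((|(hermPoly n).eval x| ^ p * (hermPoly n).eval x) *
          Real.exp (-((p + 1) / 2) * x ^ 2) : ℝ) : ℂ)) := fun x => by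
    rw [vNL_eq]; ring
  simp only [fourier1]
  simp_rw [hpt]
  rw [integral_const_mul, norm_mul, norm_mul, norm_pow, Complex.norm_I, one_pow, one_mul,
    Complex.norm_real, Real.norm_of_nonneg (by positivity), mul_assoc]
  exact mul_le_mul_of_nonneg_left (hK ξ) (by positivity)
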